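/- Define Λ(ξ) := ξ₃/‖ξ‖ for ξ ≠ 0, write ξ_h := (ξ₁,ξ₂,0), v^⊥ := (−v₂,v₁,0), σ̄(ξ,η) := ξ₃η_h − η₃ξ_h, and set F(ξ,η) := σ̄(ξ,η)·(ξ_h−η_h)/‖ξ−η‖³ (= S_ηΦ) and G(ξ,η) := Λ(ξ−η)·(η₁ξ₂−η₂ξ₁)/‖ξ−η‖² (= Ω_ηΦ). Let ξ, η ∈ ℝ³ with ξ ≠ η. Then the maps η' ↦ F(ξ,η') and η' ↦ G(ξ,η') are differentiable at η and the following three identities hold: (i) (ξ−η)·∇_η F(ξ,η) = F(ξ,η); (ii) (ξ_h−η_h)^⊥·∇_η F(ξ,η) = G(ξ,η); (iii) (ξ−η)·∇_η G(ξ,η) = G(ξ,η). -/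

import Mathlib

open MeasureTheory RealInnerProductSpace

noncomputable section

/-- Euclidean 3-space. -/
abbrev E3 : Type := EuclideanSpace ℝ (Fin 3)

/-- The vector `(a, b, c) ∈ ℝ³`. -/
def Ev3 (a b c : ℝ) : E3 := (WithLp.equiv 2 (Fin 3 → ℝ)).symm ![a, b, c]

/-- Horizontal part `v_h = (v₁, v₂, 0)` of a vector `v ∈ ℝ³`. -/
def hpart (v : E3) : E3 := Ev3 (v 0) (v 1) 0

/-- Horizontal rotation by 90 degrees: `v_h^⊥ = (−v₂, v₁, 0)`. -/
def hperp (v : E3) : E3 := Ev3 (-(v 1)) (v 0) 0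

/-- The quantity `σ̄(ξ,η) := ξ₃ η_h − η₃ ξ_h`. -/
def sigmaBar (ξ η : E3) : E3 := (ξ 2) • hpart η - (η 2) • hpart ξ

/-- The dispersion relation `Λ(ξ) = ξ₃ / ‖ξ‖`. -/
def Lam (ξ : E3) : ℝ := ξ 2 / ‖ξ‖

/-- `s(ξ) := √(1 − Λ(ξ)²)`. -/
def sfun (ξ : E3) : ℝ := Real.sqrt (1 - Lam ξ ^ 2)

/-- The vertical unit vector `e₃`. -/
def e₃ : E3 := Ev3 0 0 1

/-- The direction `w(ξ) = (Λ(ξ)/s(ξ)) ξ_h − ‖ξ‖ s(ξ) e₃` of the vector field `Υ = ∂_φ`. -/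
def wvec (ξ : E3) : E3 := (Lam ξ / sfun ξ) • hpart ξ - (‖ξ‖ * sfun ξ) • e₃

/-- `F(ξ,η) = S_ηΦ = σ̄(ξ,η)·(ξ_h−η_h)/‖ξ−η‖³`. -/
def Ffun (ξ η : E3) : ℝ := ⟪sigmaBar ξ η, hpart ξ - hpart η⟫ / ‖ξ - η‖ ^ 3

/-- `G(ξ,η) = Ω_ηΦ = Λ(ξ−η)(η₁ξ₂−η₂ξ₁)/‖ξ−η‖²`. -/
def Gfun (ξ η : E3) : ℝ := Lam (ξ - η) * (η 0 * ξ 1 - η 1 * ξ 0) / ‖ξ - η‖ ^ 2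

lemma Ffun_eq (ξ η : E3) : Ffun ξ η =
    ((ξ 2 * η 0 - η 2 * ξ 0) * (ξ 0 - η 0) + (ξ 2 * η 1 - η 2 * ξ 1) * (ξ 1 - η 1)) /
      ‖ξ - η‖ ^ 3 := by
  simp [Ffun, sigmaBar, hpart, Ev3, PiLp.inner_apply, Fin.sum_univ_three]
  ring

lemma Gfun_eq (ξ η : E3) : Gfun ξ η =
    (ξ 2 - η 2) * (η 0 * ξ 1 - η 1 * ξ 0) / ‖ξ - η‖ ^ 3 := by
  rw [Gfun, Lam, PiLp.sub_apply, div_mul_eq_mul_div, div_div, ← pow_succ']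

lemma hasFDerivAt_norm_sub {E : Type*} [NormedAddCommGroup E] [InnerProductSpace ℝ E]
    {x y : E} (h : x ≠ y) :
    HasFDerivAt (fun y' : E => ‖x - y'‖) (-(‖x - y‖⁻¹ • innerSL ℝ (x - y))) y := by
  have h0 : ‖x - y‖ ≠ 0 := norm_ne_zero_iff.2 (sub_ne_zero.2 h)
  have h1 := (((hasFDerivAt_id y).const_sub x).norm_sq).sqrt (pow_ne_zero 2 h0)
  simp only [id, Real.sqrt_sq (norm_nonneg _)] at h1
  refine h1.congr_fderiv ?_
  ext v
  simp
  field_simp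
  ring

lemma fderiv_div_norm_sub_pow_three {E : Type*} [NormedAddCommGroup E] [InnerProductSpace ℝ E]
    {x y : E} (h : x ≠ y) {N : E → ℝ} {N' : E →L[ℝ] ℝ} (hN : HasFDerivAt N N' y) :
    DifferentiableAt ℝ (fun y' => N y' / ‖x - y'‖ ^ 3) y ∧
    ∀ v, fderiv ℝ (fun y' => N y' / ‖x - y'‖ ^ 3) y v =
      N' v / ‖x - y‖ ^ 3 + 3 * N y * ⟪x - y, v⟫ / ‖x - y‖ ^ 5 := by
  have h0 : ‖x - y‖ ≠ 0 := norm_ne_zero_iff.2 (sub_ne_zero.2 h)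
  have h1 := hN.fun_mul (HasDerivAt.comp_hasFDerivAt (f := fun y' => ‖x - y'‖ ^ 3) y
    (hasDerivAt_inv (pow_ne_zero 3 h0)) ((hasFDerivAt_norm_sub h).pow 3))
  simp only [Function.comp_apply, ← div_eq_mul_inv] at h1
  refine ⟨h1.differentiableAt, fun v => ?_⟩
  rw [h1.fderiv]
  simp [inner_sub_left]
  field_simp
  ring

lemma hasFDerivAt_coord (i : Fin 3) (η : E3) :
    HasFDerivAt (fun η' : E3 => η' i) (EuclideanSpace.proj i : E3 →L[ℝ] ℝ) η :=
  (EuclideanSpace.proj i : E3 →L[ℝ] ℝ).hasFDerivAt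

/-- **Mixed second-order formulas (Lemma A.1, equations (A.6)–(A.8)):**
`S_{ξ−η}S_ηΦ = S_ηΦ`, `Ω_{ξ−η}S_ηΦ = Ω_ηΦ`, `S_{ξ−η}Ω_ηΦ = Ω_ηΦ`. -/
theorem stmt_17 (ξ η : E3) (hne : ξ ≠ η) :
    DifferentiableAt ℝ (fun η' : E3 => Ffun ξ η') η ∧
    DifferentiableAt ℝ (fun η' : E3 => Gfun ξ η') η ∧
    fderiv ℝ (fun η' : E3 => Ffun ξ η') η (ξ - η) = Ffun ξ η ∧
    fderiv ℝ (fun η' : E3 => Ffun ξ η') η (hperp (ξ - η)) = Gfun ξ η ∧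
    fderiv ℝ (fun η' : E3 => Gfun ξ η') η (ξ - η) = Gfun ξ η := by
  have h0 : ‖ξ - η‖ ≠ 0 := norm_ne_zero_iff.2 (sub_ne_zero.2 hne)
  have c := fun i => hasFDerivAt_coord i η
  obtain ⟨dF, fF⟩ := fderiv_div_norm_sub_pow_three hne
    (((((c 0).const_mul (ξ 2)).fun_sub ((c 2).mul_const (ξ 0))).fun_mul
        ((c 0).const_sub (ξ 0))).fun_add
      ((((c 1).const_mul (ξ 2)).fun_sub ((c 2).mul_const (ξ 1))).fun_mul
        ((c 1).const_sub (ξ 1))))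
  obtain ⟨dG, fG⟩ := fderiv_div_norm_sub_pow_three hne
    (((c 2).const_sub (ξ 2)).fun_mul
      (((c 0).mul_const (ξ 1)).fun_sub ((c 1).mul_const (ξ 0))))
  have hperp_inner : ⟪ξ - η, hperp (ξ - η)⟫ = 0 := by
    simp [hperp, Ev3, PiLp.inner_apply, Fin.sum_univ_three]
    ring
  simp only [Ffun_eq, Gfun_eq]
  refine ⟨dF, dG, ?_, ?_, ?_⟩
  · rw [fF, real_inner_self_eq_norm_sq]
    simp
    field_simp
    ring
  · rw [fF, hperp_inner]
    simp [hperp, Ev3]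
    field_simp
    ring
  · rw [fG, real_inner_self_eq_norm_sq]
    simp
    field_simp
    ring
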